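/- arXiv:1611.07235 — 3 statements merged into one kernel-verified Lean document; each statement's English description precedes it below -/
import Mathlib

section
/- Let P_1,…,P_s ∈ F⟨x_1,…,x_n⟩, where each P_i = L_{i,1}·L_{i,2}·⋯·L_{i,D} is a product of exactly D homogeneous linear forms. Then there exists a subset I ⊆ {1,…,D} of size at most s−1 such that for every choice of nonzero scalars β_1,…,β_s ∈ F\{0}: Σ_{i=1}^s β_i P_i = 0 in F⟨x_1,…,x_n⟩ if and only if Σ_{i=1}^s β_i P_{i,I} = 0 in F[z_1,…,z_n]⟨x_1,…,x_n⟩, where P_{i,I} denotes the I-projection of P_i. -/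
/-!
STATEMENT 2: For products `P_i = L_{i,1}⋯L_{i,D}` of `D` homogeneous linear forms in
`F⟨x_1,…,x_n⟩` there is an index set `I ⊆ [D]` of size at most `s-1` such that for all
nonzero scalars `β_i`, `∑ β_i P_i = 0` iff `∑ β_i P_{i,I} = 0`, where `P_{i,I}` is the
`I`-projection in `F[z_1,…,z_n]⟨x_1,…,x_n⟩`: factors at positions in `I` stay
noncommutative, and factors at other positions are replaced by the corresponding
central commutative linear form in the `z` variables.
-/

noncomputable section

/-- The free noncommutative polynomial algebra `R⟨x_1,…,x_n⟩` over a commutative ring `R`,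
realized as the monoid algebra of the free monoid of words over `Fin n`. -/
abbrev FreeNC (R : Type*) [CommSemiring R] (n : ℕ) : Type _ :=
  MonoidAlgebra R (FreeMonoid (Fin n))

/-- The homogeneous linear form `∑ i, c i * x i` in `F⟨x_1,…,x_n⟩`. -/
def linForm {F : Type*} [CommSemiring F] {n : ℕ} (c : Fin n → F) : FreeNC F n :=
  ∑ i, MonoidAlgebra.single (FreeMonoid.of i) (c i)

/-- The `j`-th factor of the `I`-projection of a product of linear forms: if `j ∈ I`, the
linear form `∑ i, c i * x i` in the noncommuting variables (with coefficients viewed in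
`F[z_1,…,z_n]`); otherwise the central scalar `∑ i, c i * z i ∈ F[z_1,…,z_n]`. -/
def projFactor {F : Type*} [Field F] {n : ℕ} (c : Fin n → F) (inI : Prop) [Decidable inI] :
    FreeNC (MvPolynomial (Fin n) F) n :=
  if inI then
    ∑ i, MonoidAlgebra.single (FreeMonoid.of i) (MvPolynomial.C (c i))
  else
    MonoidAlgebra.single (1 : FreeMonoid (Fin n))
      (∑ i, MvPolynomial.C (c i) * MvPolynomial.X i)

section Tensor

variable {F : Type*} [Field F] {n D : ℕ}

/-- The coefficient of the `I`-projection of `∏ j, ∑ k, c j k * x k` at the word that has the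
letter `w j` at each position `j ∈ I`. The letters of `w` outside `I` are ignored. -/
def projCoeff (I : Finset (Fin D)) (c : Fin D → Fin n → F) (w : Fin D → Fin n) :
    MvPolynomial (Fin n) F :=
  ∏ j, if j ∈ I then MvPolynomial.C (c j (w j))
    else ∑ k, MvPolynomial.C (c j k) * MvPolynomial.X k

theorem projCoeff_univ (c : Fin D → Fin n → F) (w : Fin D → Fin n) :
    projCoeff Finset.univ c w = MvPolynomial.C (∏ j, c j (w j)) := by
  simp [projCoeff]

theorem projCoeff_eq_sum_insert {I : Finset (Fin D)} {j : Fin D} (hj : j ∉ I)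
    (c : Fin D → Fin n → F) (w : Fin D → Fin n) :
    projCoeff I c w =
      ∑ k, MvPolynomial.X k * projCoeff (insert j I) c (Function.update w j k) := by
  classical
  unfold projCoeff
  rw [← Finset.mul_prod_erase _ _ (Finset.mem_univ j), if_neg hj, Finset.sum_mul]
  refine Finset.sum_congr rfl fun k _ => ?_
  rw [← Finset.mul_prod_erase _ _ (Finset.mem_univ j), if_pos (Finset.mem_insert_self j I),
    Function.update_self, ← mul_assoc, mul_comm (MvPolynomial.X k)]
  congr 1
  refine Finset.prod_congr rfl fun l hl => ?_
  have hlj := Finset.ne_of_mem_erase hl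
  simp [hlj]

theorem projCoeff_eq_C_mul {I : Finset (Fin D)} {j : Fin D} (hj : j ∈ I)
    (c : Fin D → Fin n → F) (w : Fin D → Fin n) :
    projCoeff I c w =
      MvPolynomial.C (c j (w j)) * projCoeff I (Function.update c j 1) w := by
  classical
  unfold projCoeff
  rw [← Finset.mul_prod_erase _ _ (Finset.mem_univ j),
    ← Finset.mul_prod_erase _ (fun l => ite (l ∈ I) _ _) (Finset.mem_univ j),
    if_pos hj, if_pos hj, Function.update_self, Pi.one_apply, map_one, one_mul]
  congr 1
  refine Finset.prod_congr rfl fun l hl => ?_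
  have hlj := Finset.ne_of_mem_erase hl
  simp [hlj]

theorem projCoeff_update_one {I : Finset (Fin D)} {j : Fin D} (hj : j ∈ I)
    (c : Fin D → Fin n → F) (w : Fin D → Fin n) (k : Fin n) :
    projCoeff I (Function.update c j 1) (Function.update w j k) =
      projCoeff I (Function.update c j 1) w := by
  classical
  unfold projCoeff
  refine Finset.prod_congr rfl fun l _ => ?_
  rcases eq_or_ne l j with rfl | hlj
  · simp [hj]
  · simp [hlj]

theorem projCoeff_univ_eq_zero {c : Fin D → Fin n → F} {w : Fin D → Fin n}
    (h : projCoeff ∅ c w = 0) (v : Fin D → Fin n) : projCoeff Finset.univ c v = 0 := by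
  classical
  unfold projCoeff at h
  obtain ⟨j, -, hj⟩ := Finset.prod_eq_zero_iff.1 h
  rw [if_neg (Finset.notMem_empty j)] at hj
  have hc : c j (v j) = 0 := by
    have := congrArg (MvPolynomial.coeff (Finsupp.single (v j) 1)) hj
    simpa [MvPolynomial.coeff_sum, MvPolynomial.coeff_C_mul, MvPolynomial.coeff_X,
      Finsupp.single_left_inj] using this
  rw [projCoeff_univ, Finset.prod_eq_zero (Finset.mem_univ j) hc, map_zero]

variable {ι : Type*} [Fintype ι]

/-- `β` is a linear relation between the `I`-projections of the products given by `L`. -/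
def IsProjRelation (L : ι → Fin D → Fin n → F) (I : Finset (Fin D)) (β : ι → F) : Prop :=
  ∀ w, ∑ i, β i • projCoeff I (L i) w = 0

variable {L : ι → Fin D → Fin n → F} {I J : Finset (Fin D)} {β γ : ι → F}

namespace IsProjRelation

theorem add (h : IsProjRelation L I β) (h' : IsProjRelation L I γ) :
    IsProjRelation L I (β + γ) := fun w => by
  simp [add_smul, Finset.sum_add_distrib, h w, h' w]

theorem smul (a : F) (h : IsProjRelation L I β) : IsProjRelation L I (a • β) := fun w => by
  simp [mul_smul, ← Finset.smul_sum, h w]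

theorem mono (hIJ : I ⊆ J) (h : IsProjRelation L J β) : IsProjRelation L I β := by
  classical
  induction J using Finset.strongInduction with
  | H J ih =>
    rcases hIJ.eq_or_ssubset with rfl | hss
    · exact h
    · obtain ⟨j, hjJ, hjI⟩ := Finset.exists_of_ssubset hss
      refine ih (J.erase j) (Finset.erase_ssubset hjJ) (Finset.subset_erase.2 ⟨hIJ, hjI⟩)
        fun w => ?_
      simp_rw [projCoeff_eq_sum_insert (Finset.notMem_erase j J), Finset.insert_erase hjJ,
        Finset.smul_sum, ← mul_smul_comm]
      rw [Finset.sum_comm]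
      refine Finset.sum_eq_zero fun k _ => ?_
      rw [← Finset.mul_sum, h, mul_zero]

/-- Extracting the coefficient of `x k` at a position `j ∈ I`. -/
theorem extract {j : Fin D} (hj : j ∈ I) (h : IsProjRelation L I β) (k : Fin n) :
    IsProjRelation (fun i => Function.update (L i) j 1) I fun i => β i * L i j k := fun w => by
  rw [← h (Function.update w j k)]
  refine Finset.sum_congr rfl fun i _ => ?_
  rw [projCoeff_eq_C_mul hj (L i), Function.update_self, projCoeff_update_one hj, mul_smul,
    MvPolynomial.smul_eq_C_mul (a := L i j k)]

theorem of_extract {j : Fin D} (hj : j ∈ I)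
    (h : ∀ k, IsProjRelation (fun i => Function.update (L i) j 1) I fun i => β i * L i j k) :
    IsProjRelation L I β := fun w => by
  rw [← h (w j) w]
  refine Finset.sum_congr rfl fun i _ => ?_
  rw [projCoeff_eq_C_mul hj (L i), mul_smul, MvPolynomial.smul_eq_C_mul (a := L i j (w j))]

end IsProjRelation

/-- Every relation supported on `S` between `I`-projections lifts to a relation between the
products themselves. -/
def ReflectsRelations (L : ι → Fin D → Fin n → F) (S : Finset ι) (I : Finset (Fin D)) : Prop :=
  ∀ β : ι → F, (∀ i ∉ S, β i = 0) → IsProjRelation L I β → IsProjRelation L Finset.univ β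

theorem ReflectsRelations.of_erase [DecidableEq ι] {S : Finset ι} {i₀ : ι}
    (hβS : ∀ i ∉ S, β i = 0) (hβ : IsProjRelation L Finset.univ β) (hi₀ : β i₀ ≠ 0)
    (h : ReflectsRelations L (S.erase i₀) I) : ReflectsRelations L S I := by
  intro γ hγS hγ
  have key := h (γ + (-(γ i₀ / β i₀)) • β) (fun i hi => ?_)
    (hγ.add ((hβ.mono (Finset.subset_univ I)).smul _))
  · have := key.add (hβ.smul (γ i₀ / β i₀))
    simpa [add_assoc] using this
  · rcases eq_or_ne i i₀ with rfl | hne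
    · simp [hi₀]
    · have hiS : i ∉ S := fun hS => hi (Finset.mem_erase.2 ⟨hne, hS⟩)
      simp [hβS i hiS, hγS i hiS]

theorem reflectsRelations_empty_of_card_le_one {S : Finset ι} (hS : S.card ≤ 1) :
    ReflectsRelations L S ∅ := by
  classical
  intro β hβS hβ w
  refine Finset.sum_eq_zero fun i _ => ?_
  by_cases hi : i ∈ S
  · have hz := hβ w
    rw [Finset.sum_eq_single i, smul_eq_zero] at hz
    · rcases hz with hz | hz
      · rw [hz, zero_smul]
      · rw [projCoeff_univ_eq_zero hz, smul_zero]
    · intro l _ hl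
      rw [hβS l fun hlS => hl (Finset.card_le_one.1 hS l hlS i hi), zero_smul]
    · simp
  · rw [hβS i hi, zero_smul]

/-- Two linearly independent products have non-proportional factors at some position. -/
theorem exists_factor_ne {i₁ i₂ : ι} (hne : i₁ ≠ i₂)
    (hind : ∀ β : ι → F, (∀ i, i ≠ i₁ → i ≠ i₂ → β i = 0) →
      IsProjRelation L Finset.univ β → β = 0) :
    ∃ j k l, L i₁ j l * L i₂ j k ≠ L i₁ j k * L i₂ j l := by
  classical
  by_contra! hcon
  have hcomm (v w : Fin D → Fin n) : (∏ j, L i₁ j (v j)) * ∏ j, L i₂ j (w j) =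
      (∏ j, L i₁ j (w j)) * ∏ j, L i₂ j (v j) := by
    rw [← Finset.prod_mul_distrib, ← Finset.prod_mul_distrib]
    exact Finset.prod_congr rfl fun j _ => hcon j _ _
  have hzero (v : Fin D → Fin n) : ∏ j, L i₁ j (v j) = 0 := by
    have := hind (Pi.single i₁ (∏ j, L i₂ j (v j)) + Pi.single i₂ (-∏ j, L i₁ j (v j)))
      (fun i h₁ h₂ => by simp [h₁, h₂]) fun w => by
        simp only [Pi.add_apply, add_smul, Finset.sum_add_distrib, Pi.single_apply, ite_smul,
          zero_smul, Finset.sum_ite_eq', Finset.mem_univ, if_true, projCoeff_univ,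
          MvPolynomial.smul_eq_C_mul, ← map_mul, ← map_add]
        rw [neg_mul, hcomm v w, mul_comm, add_neg_cancel, map_zero]
    simpa [hne.symm] using congrFun this i₂
  have := hind (Pi.single i₁ 1) (fun i h₁ _ => by simp [h₁]) fun w => by
    simp [Pi.single_apply, ite_smul, projCoeff_univ, hzero, -map_prod]
  simpa using congrFun this i₁

theorem ReflectsRelations.insert_of_update_one {S : Finset ι} {j : Fin D}
    (h : ReflectsRelations (fun i => Function.update (L i) j 1) S I) :
    ReflectsRelations L S (insert j I) := by
  intro β hβS hβ
  refine IsProjRelation.of_extract (Finset.mem_univ j) fun k => ?_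
  have hk := (hβ.extract (Finset.mem_insert_self j I) k).mono (Finset.subset_insert j I)
  exact h _ (fun i hi => by simp [hβS i hi]) hk

/-- If the products with the factors at position `j` removed are linearly independent, one can
split `S` by whether the linear functional `v ↦ a * v k - b * v l` vanishes on the `j`-th factor. -/
theorem ReflectsRelations.insert_union [DecidableEq F]
    {S : Finset ι} {j : Fin D} {k l : Fin n} {a b : F}
    (hind : ∀ β : ι → F, (∀ i ∉ S, β i = 0) →
      IsProjRelation (fun i => Function.update (L i) j 1) Finset.univ β → β = 0)
    (hI : ReflectsRelations (fun i => Function.update (L i) j 1)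
      {i ∈ S | a * L i j k - b * L i j l ≠ 0} I)
    (hJ : ReflectsRelations L {i ∈ S | ¬(a * L i j k - b * L i j l ≠ 0)} J) :
    ReflectsRelations L S (insert j (I ∪ J)) := by
  intro β hβS hβ
  have hj := Finset.mem_insert_self j (I ∪ J)
  have hrel : IsProjRelation (fun i => Function.update (L i) j 1) (insert j (I ∪ J))
      fun i => β i * (a * L i j k - b * L i j l) := by
    convert ((hβ.extract hj k).smul a).add ((hβ.extract hj l).smul (-b)) using 1
    funext i
    simp only [Pi.add_apply, Pi.smul_apply, smul_eq_mul]
    ring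
  have hzero := hind _ (fun i hi => by simp [hβS i hi]) <| hI _ (fun i hi => by
      by_cases hiS : i ∈ S
      · rw [mul_eq_zero, or_iff_not_imp_right]
        exact fun h => absurd (Finset.mem_filter.2 ⟨hiS, h⟩) hi
      · simp [hβS i hiS])
    (hrel.mono (Finset.subset_union_left.trans (Finset.subset_insert _ _)))
  refine hJ β (fun i hi => ?_)
    (hβ.mono (Finset.subset_union_right.trans (Finset.subset_insert _ _)))
  by_cases hiS : i ∈ S
  · refine (mul_eq_zero.1 (congrFun hzero i)).resolve_right fun h => hi ?_
    exact Finset.mem_filter.2 ⟨hiS, fun h' => h' h⟩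
  · exact hβS i hiS

theorem exists_card_le_reflectsRelations (L : ι → Fin D → Fin n → F) (S : Finset ι) :
    ∃ I : Finset (Fin D), I.card ≤ S.card - 1 ∧ ReflectsRelations L S I := by
  classical
  induction S using Finset.strongInduction generalizing L with
  | H S ih =>
    rcases le_or_gt S.card 1 with hS | hS
    · exact ⟨∅, by simp, reflectsRelations_empty_of_card_le_one hS⟩
    have hdep (L' : ι → Fin D → Fin n → F)
        (hcon : ¬∀ β : ι → F, (∀ i ∉ S, β i = 0) → IsProjRelation L' Finset.univ β → β = 0) :
        ∃ I : Finset (Fin D), I.card + 1 ≤ S.card - 1 ∧ ReflectsRelations L' S I := by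
      push Not at hcon
      obtain ⟨β, hβS, hβ, hβ0⟩ := hcon
      obtain ⟨i₀, hi₀⟩ := Function.ne_iff.1 hβ0
      have hi₀S : i₀ ∈ S := by_contra fun h => hi₀ (hβS i₀ h)
      obtain ⟨I, hIcard, hI⟩ := ih (S.erase i₀) (Finset.erase_ssubset hi₀S) L'
      rw [Finset.card_erase_of_mem hi₀S] at hIcard
      exact ⟨I, by omega, hI.of_erase hβS hβ hi₀⟩
    by_cases hind : ∀ β : ι → F, (∀ i ∉ S, β i = 0) → IsProjRelation L Finset.univ β → β = 0
    swap
    · obtain ⟨I, hIcard, hI⟩ := hdep L hind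
      exact ⟨I, by omega, hI⟩
    obtain ⟨i₁, hi₁, i₂, hi₂, hne⟩ := Finset.one_lt_card.1 hS
    obtain ⟨j, k, l, hjkl⟩ := exists_factor_ne (L := L) hne fun β hβ =>
      hind β fun i hi => hβ i (fun h => hi (h ▸ hi₁)) fun h => hi (h ▸ hi₂)
    by_cases hind' : ∀ β : ι → F, (∀ i ∉ S, β i = 0) →
        IsProjRelation (fun i => Function.update (L i) j 1) Finset.univ β → β = 0
    swap
    · obtain ⟨I, hIcard, hI⟩ := hdep _ hind'
      exact ⟨insert j I, (Finset.card_insert_le j I).trans hIcard, hI.insert_of_update_one⟩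
    have hA : i₂ ∈ S.filter fun i => L i₁ j l * L i j k - L i₁ j k * L i j l ≠ 0 :=
      Finset.mem_filter.2 ⟨hi₂, sub_ne_zero.2 hjkl⟩
    have hB : i₁ ∈ S.filter fun i => ¬(L i₁ j l * L i j k - L i₁ j k * L i j l ≠ 0) :=
      Finset.mem_filter.2 ⟨hi₁, by simp [mul_comm]⟩
    obtain ⟨I, hIcard, hI⟩ := ih _
      (Finset.filter_ssubset (p := fun i => L i₁ j l * L i j k - L i₁ j k * L i j l ≠ 0) |>.2
        ⟨i₁, hi₁, (Finset.mem_filter.1 hB).2⟩)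
      fun i => Function.update (L i) j 1
    obtain ⟨J, hJcard, hJ⟩ := ih _
      (Finset.filter_ssubset (p := fun i => ¬(L i₁ j l * L i j k - L i₁ j k * L i j l ≠ 0)) |>.2
        ⟨i₂, hi₂, not_not.2 (Finset.mem_filter.1 hA).2⟩) L
    refine ⟨insert j (I ∪ J), ?_, .insert_union hind' hI hJ⟩
    have hAB := Finset.card_filter_add_card_filter_not (s := S)
      fun i => L i₁ j l * L i j k - L i₁ j k * L i j l ≠ 0
    have hApos := Finset.card_pos.2 ⟨i₂, hA⟩
    have hBpos := Finset.card_pos.2 ⟨i₁, hB⟩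
    have hle := (Finset.card_insert_le j (I ∪ J)).trans
      (Nat.add_le_add_right (Finset.card_union_le I J) 1)
    omega

end Tensor

section Words

variable {R : Type*} [CommSemiring R] {n : ℕ}

/-- The word with letter `w j` at each position `j` satisfying `p`, and no letter elsewhere. -/
def subword {D : ℕ} (p : Fin D → Prop) [DecidablePred p] (w : Fin D → Fin n) :
    FreeMonoid (Fin n) :=
  (List.ofFn fun j => if p j then FreeMonoid.of (w j) else 1).prod

/-- A factor of a product: a linear form if `q` holds and the scalar `b` otherwise. -/
def mixedFactor (q : Prop) [Decidable q] (a : Fin n → R) (b : R) : FreeNC R n :=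
  if q then linForm a else MonoidAlgebra.single 1 b

theorem coeff_linForm_mul_of_mul (a : Fin n → R) (f : FreeNC R n) (k : Fin n)
    (u : FreeMonoid (Fin n)) :
    (linForm a * f).coeff (FreeMonoid.of k * u) = a k * f.coeff u := by
  rw [linForm, Finset.sum_mul, MonoidAlgebra.coeff_sum, Finsupp.finsetSum_apply,
    Finset.sum_eq_single k, MonoidAlgebra.coeff_single_mul_mul]
  · intro l _ hl
    refine MonoidAlgebra.coeff_single_mul_of_forall_mul_ne _ _ fun d hd => hl ?_
    exact (List.cons.inj (congrArg FreeMonoid.toList hd)).1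
  · simp

theorem coeff_linForm_mul_one (a : Fin n → R) (f : FreeNC R n) :
    (linForm a * f).coeff 1 = 0 := by
  rw [linForm, Finset.sum_mul, MonoidAlgebra.coeff_sum, Finsupp.finsetSum_apply]
  refine Finset.sum_eq_zero fun l _ => ?_
  refine MonoidAlgebra.coeff_single_mul_of_forall_mul_ne _ _ fun d hd => ?_
  exact List.cons_ne_nil _ _ (congrArg FreeMonoid.toList hd)

theorem coeff_prod_mixedFactor_subword {D : ℕ} (p : Fin D → Prop) [DecidablePred p]
    (a : Fin D → Fin n → R) (b : Fin D → R) (w : Fin D → Fin n) :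
    (List.ofFn fun j => mixedFactor (p j) (a j) (b j)).prod.coeff (subword p w) =
      ∏ j, if p j then a j (w j) else b j := by
  induction D with
  | zero => simp [subword, MonoidAlgebra.one_def]
  | succ D ih =>
    have ih' := ih (fun j => p j.succ) (fun j => a j.succ) (fun j => b j.succ) fun j => w j.succ
    unfold subword at ih' ⊢
    rw [List.ofFn_succ, List.prod_cons, List.ofFn_succ, List.prod_cons, Fin.prod_univ_succ, ← ih']
    by_cases h : p 0
    · simp only [mixedFactor, if_pos h, coeff_linForm_mul_of_mul]
    · simp only [mixedFactor, if_neg h, one_mul, MonoidAlgebra.coeff_single_one_mul]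

theorem coeff_prod_mixedFactor_eq_zero {D : ℕ} (p : Fin D → Prop) [DecidablePred p]
    (a : Fin D → Fin n → R) (b : Fin D → R) (hb : IsEmpty (Fin n) → b = 0)
    {u : FreeMonoid (Fin n)} (hu : ∀ w, subword p w ≠ u) :
    (List.ofFn fun j => mixedFactor (p j) (a j) (b j)).prod.coeff u = 0 := by
  induction D generalizing u with
  | zero =>
    have : (1 : FreeMonoid (Fin n)) ≠ u := by simpa [subword] using hu Fin.elim0
    simp [MonoidAlgebra.one_def, this]
  | succ D ih =>
    have ih' {v} := ih (fun j => p j.succ) (fun j => a j.succ) (fun j => b j.succ)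
      (fun h => by simp [hb h]; rfl) (u := v)
    have hsub (k : Fin n) (w : Fin D → Fin n) : subword p (Fin.cons k w) =
        (if p 0 then FreeMonoid.of k else 1) * subword (fun j => p j.succ) w := by
      simp [subword, List.ofFn_succ]
    rw [List.ofFn_succ, List.prod_cons]
    by_cases h : p 0
    · simp only [mixedFactor, if_pos h] at ih' ⊢
      cases u using FreeMonoid.casesOn with
      | one => exact coeff_linForm_mul_one _ _
      | of_mul k v =>
        rw [coeff_linForm_mul_of_mul, ih', mul_zero]
        exact fun w hw => hu (Fin.cons k w) (by rw [hsub, if_pos h, hw])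
    · simp only [mixedFactor, if_neg h, MonoidAlgebra.coeff_single_one_mul] at ih' ⊢
      rcases isEmpty_or_nonempty (Fin n) with hn | ⟨⟨k⟩⟩
      · simp [hb hn]
      · rw [ih', mul_zero]
        exact fun w hw => hu (Fin.cons k w) (by rw [hsub, if_neg h, one_mul, hw])

theorem sum_smul_prod_mixedFactor_eq_zero_iff {A ι : Type*} [CommSemiring A] [Module A R]
    [Fintype ι] {D : ℕ} (p : Fin D → Prop) [DecidablePred p] (a : ι → Fin D → Fin n → R)
    (b : ι → Fin D → R) (hb : IsEmpty (Fin n) → b = 0) (β : ι → A) :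
    (∑ i, β i • (List.ofFn fun j => mixedFactor (p j) (a i j) (b i j)).prod : FreeNC R n) = 0 ↔
      ∀ w : Fin D → Fin n, ∑ i, β i • ∏ j, (if p j then a i j (w j) else b i j) = 0 := by
  have hcoeff (u : FreeMonoid (Fin n)) :
      (∑ i, β i • (List.ofFn fun j => mixedFactor (p j) (a i j) (b i j)).prod :
        FreeNC R n).coeff u =
      ∑ i, β i • (List.ofFn fun j => mixedFactor (p j) (a i j) (b i j)).prod.coeff u := by
    rw [MonoidAlgebra.coeff_sum, Finsupp.finsetSum_apply]
    rfl
  constructor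
  · intro h w
    simp_rw [← coeff_prod_mixedFactor_subword]
    rw [← hcoeff, h]
    rfl
  · intro h
    ext u
    rw [hcoeff]
    by_cases hu : ∃ w, subword p w = u
    · obtain ⟨w, rfl⟩ := hu
      simp_rw [coeff_prod_mixedFactor_subword]
      exact h w
    · push Not at hu
      refine Finset.sum_eq_zero fun i _ => ?_
      rw [coeff_prod_mixedFactor_eq_zero p _ _ (fun hn => congrFun (hb hn) i) hu, smul_zero]

end Words

section Bridge

variable {F : Type*} [Field F] {n D : ℕ} {ι : Type*} [Fintype ι]

theorem sum_smul_prod_linForm_eq_zero_iff (L : ι → Fin D → Fin n → F) (β : ι → F) :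
    (∑ i, β i • (List.ofFn fun j => linForm (L i j)).prod : FreeNC F n) = 0 ↔
      IsProjRelation L Finset.univ β := by
  have := sum_smul_prod_mixedFactor_eq_zero_iff (fun _ => True) L 0 (fun _ => rfl) β
  simp only [mixedFactor, if_true] at this
  simp only [this, IsProjRelation, projCoeff_univ, MvPolynomial.smul_eq_C_mul, ← map_mul,
    ← map_sum, MvPolynomial.C_eq_zero, smul_eq_mul]

theorem sum_smul_prod_projFactor_eq_zero_iff (L : ι → Fin D → Fin n → F) (I : Finset (Fin D))
    (β : ι → F) :
    (∑ i, β i • (List.ofFn fun j => projFactor (L i j) (j ∈ I)).prod :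
      FreeNC (MvPolynomial (Fin n) F) n) = 0 ↔ IsProjRelation L I β :=
  sum_smul_prod_mixedFactor_eq_zero_iff (· ∈ I) (fun i j k => MvPolynomial.C (L i j k))
    (fun i j => ∑ k, MvPolynomial.C (L i j k) * MvPolynomial.X k)
    (fun _ => by ext; simp) β

end Bridge

theorem stmt2 {F : Type*} [Field F] {n s D : ℕ}
    (L : Fin s → Fin D → Fin n → F) :
    ∃ I : Finset (Fin D), I.card ≤ s - 1 ∧
      ∀ β : Fin s → F, (∀ i, β i ≠ 0) →
        ((∑ i, β i • (List.ofFn fun j => linForm (L i j)).prod) = (0 : FreeNC F n) ↔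
          (∑ i, β i • (List.ofFn fun j => projFactor (L i j) (j ∈ I)).prod)
            = (0 : FreeNC (MvPolynomial (Fin n) F) n)) := by
  obtain ⟨I, hIcard, hI⟩ := exists_card_le_reflectsRelations L Finset.univ
  rw [Finset.card_univ, Fintype.card_fin] at hIcard
  refine ⟨I, hIcard, fun β _ => ?_⟩
  rw [sum_smul_prod_linForm_eq_zero_iff, sum_smul_prod_projFactor_eq_zero_iff]
  exact ⟨.mono (Finset.subset_univ I), hI β (by simp)⟩

end
end

section
/- There is an absolute constant c > 0 with the following property. Let F be a field, and for i ∈ {1,…,k} let P_i = Π_{m=1}^D L_{i,m} ∈ F[x_{im} : 1 ≤ i ≤ n, 1 ≤ m ≤ D] be a set-multilinear product, where each L_{i,m} is a nonzero linear form in the block-m variables x_{1m},…,x_{nm}. Suppose Σ_{i=1}^k γ_i P_i = 0 with all γ_i ∈ F\{0}, and the dependence is minimal: for every nonempty proper subset S ⊊ {1,…,k}, Σ_{i∈S} γ_i P_i ≠ 0. Then for every pair of indices i, i' ∈ {1,…,k}, the number of positions m ∈ {1,…,D} at which L_{i,m} and L_{i',m} are not proportional is at most c·k^4. -/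
/-!
STATEMENT 7: There is an absolute constant `c > 0` such that for any minimal vanishing
`F`-linear dependence `∑_{i=1}^k γ_i P_i = 0` among set-multilinear products
`P_i = ∏_m L_{i,m}` of nonzero linear forms (block `m` factor using only block-`m`
variables), any two products `P_i, P_{i'}` have non-proportional factors in at most
`c·k^4` positions `m`.
-/

noncomputable section

/-- The set-multilinear copy at block `m` of the linear form with coefficient vector `c`:
`∑ i, c i * x_{i,m}` in the commutative polynomial ring `F[x_{i,m}]`. -/
def blockForm {F : Type*} [Field F] {n D : ℕ} (c : Fin n → F) (m : Fin D) :
    MvPolynomial (Fin n × Fin D) F :=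
  ∑ i, MvPolynomial.C (c i) * MvPolynomial.X (i, m)

/-- Two vectors are proportional by a nonzero scalar. -/
def Proportional {A F : Type*} [Field F] (u v : A → F) : Prop :=
  ∃ α : F, α ≠ 0 ∧ u = α • v

theorem Proportional.symm {A F : Type*} [Field F] {u v : A → F} (h : Proportional u v) :
    Proportional v u := by
  obtain ⟨α, hα, rfl⟩ := h
  exact ⟨α⁻¹, inv_ne_zero hα, by rw [smul_smul, inv_mul_cancel₀ hα, one_smul]⟩

theorem Proportional.trans {A F : Type*} [Field F] {u v w : A → F} (h : Proportional u v)
    (h' : Proportional v w) : Proportional u w := by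
  obtain ⟨α, hα, rfl⟩ := h
  obtain ⟨β, hβ, rfl⟩ := h'
  exact ⟨α * β, mul_ne_zero hα hβ, by rw [smul_smul]⟩

/-- The coefficient array of the tensor product over the blocks in `T` of the `i`-th family of
vectors, as a function of a full multi-index that ignores the blocks outside `T`. -/
def partialTensor {ι μ A F : Type*} [Field F] (L : ι → μ → A → F) (T : Finset μ) (i : ι)
    (f : μ → A) : F :=
  ∏ m ∈ T, L i m (f m)

/-- The dimension of the span of the partial tensors over the blocks in `T`. -/
def partialRank {ι μ A F : Type*} [Field F] (L : ι → μ → A → F) (T : Finset μ) : ℕ :=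
  Module.finrank F (Submodule.span F (Set.range (partialTensor L T)))

section PartialTensor

variable {ι μ A F : Type*} [Field F] [DecidableEq μ] {L : ι → μ → A → F}

theorem partialTensor_insert_update {T : Finset μ} {m : μ} (hm : m ∉ T) (i : ι) (f : μ → A)
    (x : A) :
    partialTensor L (insert m T) i (Function.update f m x) =
      L i m x * partialTensor L T i f := by
  unfold partialTensor
  rw [Finset.prod_insert hm, Function.update_self]
  congr 1
  refine Finset.prod_congr rfl fun m' hm' => ?_
  rw [Function.update_of_ne (ne_of_mem_of_not_mem hm' hm)]

theorem LinearIndependent.partialTensor_insert {κ : Type*} [Fintype κ] {T : Finset μ} {m : μ}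
    (hm : m ∉ T) (hL : ∀ i, L i m ≠ 0) {a : κ → ι}
    (h : LinearIndependent F (partialTensor L T ∘ a)) :
    LinearIndependent F (partialTensor L (insert m T) ∘ a) := by
  rw [Fintype.linearIndependent_iff] at h ⊢
  intro c hc t
  obtain ⟨x, hx⟩ := Function.ne_iff.mp (hL (a t))
  refine (mul_eq_zero.mp (h (fun t => c t * L (a t) m x) ?_ t)).resolve_right hx
  funext f
  have := congrFun hc (Function.update f m x)
  simpa [Finset.sum_apply, partialTensor_insert_update hm, mul_assoc] using this

/-- Vectors with the same span coefficients before and after adding block `m` agree at block `m`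
with the basis vectors that occur. -/
theorem proportional_of_sum_partialTensor {κ : Type*} [Fintype κ] {T : Finset μ} {m : μ}
    (hm : m ∉ T) (hL : ∀ i, L i m ≠ 0) {a : κ → ι}
    (h : LinearIndependent F (partialTensor L T ∘ a)) {j : ι} {c d : κ → F}
    (hc : ∑ t, c t • partialTensor L T (a t) = partialTensor L T j)
    (hd : ∑ t, d t • partialTensor L (insert m T) (a t) = partialTensor L (insert m T) j)
    {t : κ} (ht : d t ≠ 0) : Proportional (L (a t) m) (L j m) := by
  rw [Fintype.linearIndependent_iff] at h
  have key : ∀ x, d t * L (a t) m x = L j m x * c t := by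
    intro x
    refine sub_eq_zero.mp (h (fun t => d t * L (a t) m x - L j m x * c t) ?_ t)
    funext f
    have h₁ := congrFun hd (Function.update f m x)
    have h₂ := congrFun hc f
    simp only [Finset.sum_apply, Pi.smul_apply, smul_eq_mul,
      partialTensor_insert_update hm] at h₁ h₂
    rw [← h₂, Finset.mul_sum] at h₁
    simpa [Finset.sum_apply, sub_mul, sub_eq_zero, mul_assoc] using h₁
  obtain ⟨x, hx⟩ := Function.ne_iff.mp (hL (a t))
  have hct : c t ≠ 0 := by
    intro h0
    have := key x
    rw [h0, mul_zero] at this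
    exact mul_ne_zero ht hx this
  refine ⟨c t / d t, div_ne_zero hct ht, funext fun y => ?_⟩
  have := key y
  simp only [Pi.smul_apply, smul_eq_mul]
  field_simp
  linear_combination this

/-- If adding block `m` does not increase the rank, vanishing combinations of the tensors split
along the proportionality classes at block `m`. -/
theorem sum_filter_partialTensor_eq_zero [Fintype ι] {T : Finset μ} {m : μ}
    (hm : m ∉ T) (hL : ∀ i, L i m ≠ 0)
    (hr : partialRank L (insert m T) ≤ partialRank L T) (i : ι)
    [DecidablePred fun j => Proportional (L j m) (L i m)] {c : ι → F}
    (hc : ∑ j, c j • partialTensor L (insert m T) j = 0) :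
    ∑ j with Proportional (L j m) (L i m), c j • partialTensor L (insert m T) j = 0 := by
  obtain ⟨κ, a, ha, hspan, hli⟩ := exists_linearIndependent' F (partialTensor L T)
  have := Finite.of_injective a ha
  have := Fintype.ofFinite κ
  have hli' := hli.partialTensor_insert hm hL
  have hspan' : Submodule.span F (Set.range (partialTensor L (insert m T) ∘ a)) =
      Submodule.span F (Set.range (partialTensor L (insert m T))) := by
    have := FiniteDimensional.span_of_finite F (Set.finite_range (partialTensor L (insert m T)))
    refine Submodule.eq_of_le_of_finrank_le
      (Submodule.span_mono (Set.range_comp_subset_range _ _)) (hr.trans ?_)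
    rw [partialRank, ← hspan, finrank_span_eq_card hli, finrank_span_eq_card hli']
  have hmem : ∀ j, ∃ d : κ → F, ∑ t, d t • partialTensor L (insert m T) (a t) =
      partialTensor L (insert m T) j := fun j =>
    (Submodule.mem_span_range_iff_exists_fun F).mp
      (hspan' ▸ Submodule.subset_span (Set.mem_range_self j))
  have hmem' : ∀ j, ∃ d : κ → F, ∑ t, d t • partialTensor L T (a t) = partialTensor L T j :=
    fun j => (Submodule.mem_span_range_iff_exists_fun F).mp
      (hspan ▸ Submodule.subset_span (Set.mem_range_self j))
  choose d hd using hmem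
  choose e he using hmem'
  have hprop : ∀ j t, d j t ≠ 0 → Proportional (L (a t) m) (L j m) := fun j t ht =>
    proportional_of_sum_partialTensor hm hL hli (he j) (hd j) ht
  have expand : ∀ s : Finset ι, ∑ j ∈ s, c j • partialTensor L (insert m T) j =
      ∑ t, (∑ j ∈ s, c j * d j t) • partialTensor L (insert m T) (a t) := by
    intro s
    simp_rw [Finset.sum_smul]
    rw [Finset.sum_comm]
    refine Finset.sum_congr rfl fun j _ => ?_
    simp_rw [mul_smul]
    rw [← Finset.smul_sum, hd]
  rw [expand] at hc ⊢
  have hzero := Fintype.linearIndependent_iff.mp hli' _ hc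
  refine Finset.sum_eq_zero fun t _ => ?_
  convert zero_smul F _
  by_cases hat : Proportional (L (a t) m) (L i m)
  · rw [← hzero t]
    refine Finset.sum_subset (Finset.subset_univ _) fun j _ hj => ?_
    by_contra hne
    exact hj (Finset.mem_filter.mpr ⟨Finset.mem_univ _,
      (hprop j t (right_ne_zero_of_mul hne)).symm.trans hat⟩)
  · refine Finset.sum_eq_zero fun j hj => ?_
    by_contra hne
    exact hat ((hprop j t (right_ne_zero_of_mul hne)).trans (Finset.mem_filter.mp hj).2)

theorem partialTensor_piecewise [Fintype μ] (T : Finset μ) (i : ι) (f g : μ → A) :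
    partialTensor L Finset.univ i (T.piecewise f g) =
      partialTensor L Tᶜ i g * partialTensor L T i f := by
  unfold partialTensor
  rw [← Finset.prod_compl_mul_prod T]
  congr 1
  · refine Finset.prod_congr rfl fun m hm => ?_
    rw [Finset.piecewise_eq_of_notMem _ _ _ (Finset.mem_compl.mp hm)]
  · refine Finset.prod_congr rfl fun m hm => ?_
    rw [Finset.piecewise_eq_of_mem _ _ _ hm]

variable [Fintype ι] [Fintype μ] {γ : ι → F}

/-- In a minimal vanishing sum, adding a block whose vectors are not all proportional strictly
increases the rank. -/
theorem partialRank_lt_insert (hL : ∀ i m, L i m ≠ 0)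
    (hsum : ∑ i, γ i • partialTensor L Finset.univ i = 0)
    (hmin : ∀ S : Finset ι, S.Nonempty → S ≠ Finset.univ →
      ∑ i ∈ S, γ i • partialTensor L Finset.univ i ≠ 0)
    {T : Finset μ} {m : μ} (hm : m ∉ T) {i i' : ι} (hi : ¬ Proportional (L i m) (L i' m)) :
    partialRank L T < partialRank L (insert m T) := by
  classical
  by_contra! hr
  refine hmin {j | Proportional (L j m) (L i' m)} ?_ ?_ (funext fun f => ?_)
  · exact ⟨i', Finset.mem_filter.mpr
      ⟨Finset.mem_univ _, 1, one_ne_zero, (one_smul F _).symm⟩⟩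
  · intro h
    exact hi (Finset.filter_eq_self.mp h i (Finset.mem_univ i))
  · have key := sum_filter_partialTensor_eq_zero hm (hL · m) hr i'
      (c := fun j => γ j * partialTensor L (insert m T)ᶜ j f) (funext fun f' => by
        have := congrFun hsum ((insert m T).piecewise f' f)
        simpa [Finset.sum_apply, partialTensor_piecewise, mul_assoc] using this)
    have := congrFun key f
    simp only [Finset.sum_apply, Pi.smul_apply, smul_eq_mul, mul_assoc,
      ← partialTensor_piecewise, Finset.piecewise_same] at this
    simpa [Finset.sum_apply] using this

theorem card_le_partialRank (hL : ∀ i m, L i m ≠ 0)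
    (hsum : ∑ i, γ i • partialTensor L Finset.univ i = 0)
    (hmin : ∀ S : Finset ι, S.Nonempty → S ≠ Finset.univ →
      ∑ i ∈ S, γ i • partialTensor L Finset.univ i ≠ 0)
    {i i' : ι} (T : Finset μ) (hT : ∀ m ∈ T, ¬ Proportional (L i m) (L i' m)) :
    T.card ≤ partialRank L T := by
  induction T using Finset.induction_on with
  | empty => simp
  | insert m T hm ih =>
    rw [Finset.card_insert_of_notMem hm]
    exact (ih fun m' hm' => hT m' (Finset.mem_insert_of_mem hm')).trans_lt
      (partialRank_lt_insert hL hsum hmin hm (hT m (Finset.mem_insert_self m T)))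

/-- In a minimal vanishing sum of pure tensors, the number of blocks at which two of the summands
have non-proportional factors is at most the number of summands. -/
theorem card_not_proportional_le (hL : ∀ i m, L i m ≠ 0)
    (hsum : ∑ i, γ i • partialTensor L Finset.univ i = 0)
    (hmin : ∀ S : Finset ι, S.Nonempty → S ≠ Finset.univ →
      ∑ i ∈ S, γ i • partialTensor L Finset.univ i ≠ 0) (i i' : ι) :
    Nat.card {m : μ // ¬ Proportional (L i m) (L i' m)} ≤ Fintype.card ι := by
  classical
  rw [Nat.card_eq_fintype_card, Fintype.card_subtype]
  exact (card_le_partialRank hL hsum hmin (i := i) (i' := i') _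
    fun m hm => (Finset.mem_filter.mp hm).2).trans (finrank_range_le_card _)

end PartialTensor

theorem prod_blockForm {F : Type*} [Field F] {n D : ℕ} (c : Fin D → Fin n → F) :
    ∏ m, blockForm (c m) m =
      ∑ f : Fin D → Fin n, MvPolynomial.C (∏ m, c m (f m)) * ∏ m, MvPolynomial.X (f m, m) := by
  unfold blockForm
  rw [Finset.prod_univ_sum, Fintype.piFinset_univ]
  refine Finset.sum_congr rfl fun f _ => ?_
  rw [Finset.prod_mul_distrib, map_prod]

theorem eval_blockForm_indicator {F : Type*} [Field F] {n D : ℕ} (c : Fin n → F) (m : Fin D)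
    (f : Fin D → Fin n) :
    MvPolynomial.eval (fun p => if p.1 = f p.2 then 1 else 0) (blockForm c m) = c (f m) := by
  simp [blockForm]

/-- A combination of set-multilinear products vanishes iff the corresponding combination of
coefficient tensors does. -/
theorem sum_prod_blockForm_eq_zero_iff {F ι : Type*} [Field F] {n D : ℕ}
    (L : ι → Fin D → Fin n → F) (γ : ι → F) (S : Finset ι) :
    ∑ i ∈ S, γ i • ∏ m, blockForm (L i m) m = 0 ↔
      ∑ i ∈ S, γ i • partialTensor L Finset.univ i = 0 := by
  constructor
  · intro h
    funext f
    have := congrArg (MvPolynomial.eval (fun p => if p.1 = f p.2 then 1 else 0)) h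
    simpa [MvPolynomial.smul_eval, map_prod, eval_blockForm_indicator, partialTensor] using this
  · intro h
    simp_rw [prod_blockForm, Finset.smul_sum]
    rw [Finset.sum_comm]
    refine Finset.sum_eq_zero fun f _ => ?_
    simp_rw [MvPolynomial.smul_eq_C_mul, ← mul_assoc, ← map_mul]
    rw [← Finset.sum_mul, ← map_sum]
    have := congrFun h f
    simp only [Finset.sum_apply, Pi.smul_apply, smul_eq_mul, partialTensor,
      Pi.zero_apply] at this
    rw [this, map_zero, zero_mul]

theorem stmt7 :
    ∃ c : ℝ, 0 < c ∧
      ∀ (F : Type) [Field F], ∀ (n D k : ℕ)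
        (Lc : Fin k → Fin D → Fin n → F), (∀ i m, Lc i m ≠ 0) →
        ∀ (γ : Fin k → F), (∀ i, γ i ≠ 0) →
        (∑ i, γ i • ∏ m, blockForm (Lc i m) m) = 0 →
        (∀ S : Finset (Fin k), S.Nonempty → S ≠ Finset.univ →
          (∑ i ∈ S, γ i • ∏ m, blockForm (Lc i m) m) ≠ 0) →
        ∀ i i' : Fin k,
          (Nat.card {m : Fin D // ¬ ∃ α : F, α ≠ 0 ∧ Lc i m = α • Lc i' m} : ℝ)
            ≤ c * (k : ℝ) ^ 4 := by
  refine ⟨1, one_pos, fun F _ n D k L hL γ _ hsum hmin i i' => ?_⟩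
  have hle := card_not_proportional_le hL ((sum_prod_blockForm_eq_zero_iff L γ _).mp hsum)
    (fun S hS hS' h => hmin S hS hS' ((sum_prod_blockForm_eq_zero_iff L γ S).mpr h)) i i'
  rw [Fintype.card_fin] at hle
  rw [one_mul]
  exact_mod_cast hle.trans (Nat.le_self_pow four_ne_zero k)

end
end

section
/- Let k ≥ 1 and let R be the commutative polynomial ring F[z_1,…,z_n, ξ_1,…,ξ_{k+1}, x_{i,l} : 1 ≤ i ≤ n, 1 ≤ l ≤ k]. For a homogeneous linear form L = Σ_{i=1}^n c_i x_i, write L(z) = Σ_i c_i z_i and L^{(l)} = Σ_i c_i x_{i,l}, and let M_L be the (k+1)×(k+1) matrix over R with rows and columns indexed by 0,…,k, defined by: M_L[l,l] = L(z)·ξ_{l+1} for 0 ≤ l ≤ k, M_L[l,l+1] = L^{(l+1)} for 0 ≤ l ≤ k−1, and all other entries 0. Then for any homogeneous linear forms L_1,…,L_D with D ≥ k, the (0,k) entry of the matrix product M_{L_1}·M_{L_2}·⋯·M_{L_D} equals Σ over all tuples 1 ≤ j_1 < j_2 < ⋯ < j_k ≤ D of ξ_1^{j_1−1}·ξ_2^{j_2−j_1−1}·⋯·ξ_k^{j_k−j_{k−1}−1}·ξ_{k+1}^{D−j_k}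 · (Π_{1≤j<j_1} L_j(z)) · L_{j_1}^{(1)} · (Π_{j_1<j<j_2} L_j(z)) · L_{j_2}^{(2)} · ⋯ · L_{j_k}^{(k)} · (Π_{j_k<j≤D} L_j(z)). -/
/-!
STATEMENT 11: The `(0,k)` entry of the product of the `(k+1)×(k+1)` transfer matrices
`M_{L_1}⋯M_{L_D}` (over `R = F[z_1,…,z_n, ξ_1,…,ξ_{k+1}, x_{i,l}]`) equals the sum over
all `1 ≤ j_1 < ⋯ < j_k ≤ D` of
`ξ_1^{j_1-1} ξ_2^{j_2-j_1-1} ⋯ ξ_{k+1}^{D-j_k} · (∏_{j<j_1} L_j(z)) · L_{j_1}^{(1)} ⋯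
L_{j_k}^{(k)} · (∏_{j_k<j≤D} L_j(z))`.

We index the variables of `R` by `Fin n ⊕ Fin (k+1) ⊕ (Fin n × Fin k)`: the `z` variables,
the `ξ` variables (`ξ_{l+1}` is indexed by `l : Fin (k+1)`), and the `x_{i,l}` variables
(`x_{i,l+1}` indexed by `(i, l) : Fin n × Fin k`). Positions are 0-indexed: a strictly
monotone tuple `j : Fin k → Fin D` encodes `j_t = j(t-1) + 1` in the 1-indexed notation.
-/

noncomputable section

variable {F : Type*} [Field F] {n k D : ℕ}

/-- The variable index type: `z` variables, `ξ` variables, and `x_{i,l}` variables. -/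
abbrev RVar (n k : ℕ) : Type := Fin n ⊕ Fin (k + 1) ⊕ (Fin n × Fin k)

/-- `L(z) = ∑ i, c i * z i` for the linear form with coefficient vector `c`. -/
def Lz [Field F] (n k : ℕ) (c : Fin n → F) : MvPolynomial (RVar n k) F :=
  ∑ i, MvPolynomial.C (c i) * MvPolynomial.X (Sum.inl i)

/-- `L^{(l+1)} = ∑ i, c i * x_{i,l+1}` for `l : Fin k`. -/
def Lx [Field F] (n k : ℕ) (c : Fin n → F) (l : Fin k) : MvPolynomial (RVar n k) F :=
  ∑ i, MvPolynomial.C (c i) * MvPolynomial.X (Sum.inr (Sum.inr (i, l)))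

/-- The variable `ξ_{l+1}`, for `l : Fin (k+1)`. -/
def xiVar (n k : ℕ) (l : Fin (k + 1)) : MvPolynomial (RVar n k) F :=
  MvPolynomial.X (Sum.inr (Sum.inl l))

/-- The transfer matrix `M_L` of the linear form `L` with coefficient vector `c`:
`M_L[l,l] = L(z)·ξ_{l+1}`, `M_L[l,l+1] = L^{(l+1)}`, and all other entries `0`. -/
def matM [Field F] (n k : ℕ) (c : Fin n → F) :
    Matrix (Fin (k + 1)) (Fin (k + 1)) (MvPolynomial (RVar n k) F) :=
  fun p q =>
    if p = q then Lz n k c * xiVar n k p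
    else if h : (q : ℕ) = (p : ℕ) + 1 then
      Lx n k c ⟨(p : ℕ), by have := q.isLt; omega⟩
    else 0

/-- The exponent of `ξ_{t+1}` (`t : Fin (k+1)`, 0-indexed) in the term of the tuple
`j_1 < ⋯ < j_k` (encoded 0-indexed by `j : Fin k → Fin D`): the number of positions
strictly between `j_t` and `j_{t+1}` (with the conventions `j_0 = 0`, `j_{k+1} = D+1`),
i.e. `j_1 - 1`, `j_{t+1} - j_t - 1`, …, `D - j_k`. -/
def gapExp {k D : ℕ} (j : Fin k → Fin D) (t : Fin (k + 1)) : ℕ :=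
  if h0 : (t : ℕ) = 0 then
    if hk0 : k = 0 then D else (j ⟨0, Nat.pos_of_ne_zero hk0⟩ : ℕ)
  else if hkk : (t : ℕ) = k then
    D - (j ⟨k - 1, by omega⟩ : ℕ) - 1
  else
    (j ⟨(t : ℕ), by have := t.isLt; omega⟩ : ℕ) - (j ⟨(t : ℕ) - 1, by have := t.isLt; omega⟩ : ℕ) - 1

/-- The number of elements of `S` below `m`. -/
def rankBelow (S : Finset ℕ) (m : ℕ) : ℕ := (S.filter (· < m)).card

/-- The weight of the monotone lattice path with `D` steps that moves up exactly at the steps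
in `S`: staying at level `l` in step `m` costs `y m * ξ l`, leaving it costs `x m l`. -/
def pathWeight {A : Type*} [CommRing A] (ξ y : ℕ → A) (x : ℕ → ℕ → A) (D : ℕ) (S : Finset ℕ) : A :=
  ∏ m ∈ Finset.range D, if m ∈ S then x m (rankBelow S m) else y m * ξ (rankBelow S m)

/-- The upper bidiagonal transfer matrix of step `m`. -/
def stepMatrix {A : Type*} [CommRing A] (ξ y : ℕ → A) (x : ℕ → ℕ → A) (k m : ℕ) :
    Matrix (Fin (k + 1)) (Fin (k + 1)) A :=
  fun p q => if p = q then y m * ξ p else if (q : ℕ) = p + 1 then x m p else 0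

theorem rankBelow_eq_card {S : Finset ℕ} {D : ℕ} (hS : S ⊆ Finset.range D) :
    rankBelow S D = S.card := by
  rw [rankBelow, Finset.filter_true_of_mem]
  exact fun m hm => Finset.mem_range.1 (hS hm)

theorem rankBelow_insert {S : Finset ℕ} {D m : ℕ} (hm : m ≤ D) :
    rankBelow (insert D S) m = rankBelow S m := by
  rw [rankBelow, rankBelow, Finset.filter_insert, if_neg hm.not_gt]

section PathWeight

variable {A : Type*} [CommRing A] (ξ y : ℕ → A) (x : ℕ → ℕ → A)

theorem pathWeight_succ {S : Finset ℕ} {D : ℕ} (hS : S ⊆ Finset.range D) :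
    pathWeight ξ y x (D + 1) S = pathWeight ξ y x D S * (y D * ξ S.card) := by
  have hD : D ∉ S := fun h => Finset.notMem_range_self (hS h)
  rw [pathWeight, Finset.prod_range_succ, if_neg hD, rankBelow_eq_card hS, pathWeight]

theorem pathWeight_succ_insert {S : Finset ℕ} {D : ℕ} (hS : S ⊆ Finset.range D) :
    pathWeight ξ y x (D + 1) (insert D S) = pathWeight ξ y x D S * x D S.card := by
  rw [pathWeight, Finset.prod_range_succ, if_pos (Finset.mem_insert_self _ _),
    rankBelow_insert le_rfl, rankBelow_eq_card hS, pathWeight]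
  congr 1
  refine Finset.prod_congr rfl fun m hm => ?_
  have hmD := Finset.mem_range.1 hm
  simp only [rankBelow_insert hmD.le, Finset.mem_insert, hmD.ne, false_or]

theorem prod_stepMatrix_apply (k D : ℕ) (s : Fin (k + 1)) :
    ((List.range D).map (stepMatrix ξ y x k)).prod 0 s =
      ∑ S ∈ (Finset.range D).powersetCard s, pathWeight ξ y x D S := by
  induction D generalizing s with
  | zero =>
    cases s using Fin.cases with
    | zero => simp [pathWeight]
    | succ s =>
      rw [Finset.powersetCard_eq_empty.2 (by simp)]
      simp [(Fin.succ_ne_zero s).symm]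
  | succ D ih =>
    rw [List.range_succ, List.map_append, List.prod_append, Matrix.mul_apply]
    simp only [ih, List.map_cons, List.map_nil, List.prod_cons, List.prod_nil, mul_one]
    have hstay : ∀ s : ℕ,
        ∑ S ∈ (Finset.range D).powersetCard s, pathWeight ξ y x (D + 1) S =
          (∑ S ∈ (Finset.range D).powersetCard s, pathWeight ξ y x D S) * (y D * ξ s) := by
      intro s
      rw [Finset.sum_mul]
      refine Finset.sum_congr rfl fun S hS => ?_
      obtain ⟨hS, hc⟩ := Finset.mem_powersetCard.1 hS
      rw [pathWeight_succ _ _ _ hS, hc]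
    cases s using Fin.cases with
    | zero =>
      rw [Finset.sum_eq_single 0]
      · have h := hstay 0
        simp only [Finset.powersetCard_zero, Finset.sum_singleton] at h
        simp [stepMatrix, h]
      · intro p _ hp
        simp [stepMatrix, hp]
      · simp
    | succ s =>
      have hne : s.succ ≠ s.castSucc := by simp [Fin.ext_iff]
      rw [Finset.sum_eq_add_of_mem s.succ s.castSucc (Finset.mem_univ _) (Finset.mem_univ _) hne]
      · rw [Finset.range_add_one, Fin.val_succ,
          Finset.powersetCard_succ_insert Finset.notMem_range_self, Finset.sum_union, hstay,
          Finset.sum_image]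
        · congr 1
          · simp [stepMatrix]
          · rw [Finset.sum_mul]
            refine Finset.sum_congr rfl fun S hS => ?_
            obtain ⟨hS, hc⟩ := Finset.mem_powersetCard.1 hS
            rw [pathWeight_succ_insert _ _ _ hS, hc]
            simp [stepMatrix, hne.symm]
        · intro S hS T hT h
          have hS' : D ∉ S := fun h =>
            Finset.notMem_range_self ((Finset.mem_powersetCard.1 hS).1 h)
          have hT' : D ∉ T := fun h =>
            Finset.notMem_range_self ((Finset.mem_powersetCard.1 hT).1 h)
          rw [← Finset.erase_insert hS', ← Finset.erase_insert hT']
          exact congrArg (Finset.erase · D) h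
        · rw [Finset.disjoint_left]
          intro S hS hS'
          obtain ⟨T, -, rfl⟩ := Finset.mem_image.1 hS'
          exact Finset.notMem_range_self
            ((Finset.mem_powersetCard.1 hS).1 (Finset.mem_insert_self D T))
      · rintro p - ⟨hp, hp'⟩
        have : (s.succ : ℕ) ≠ p + 1 := fun h => hp' (Fin.ext (by simpa using h.symm))
        simp only [stepMatrix, if_neg hp, if_neg this, mul_zero]

end PathWeight

/-- The set of values of a tuple. -/
def valueSet (j : Fin k → Fin D) : Finset ℕ := Finset.univ.image fun t => (j t : ℕ)

theorem val_comp_injective {j : Fin k → Fin D} (hj : StrictMono j) :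
    Function.Injective fun t => (j t : ℕ) :=
  Fin.val_injective.comp hj.injective

theorem coe_mem_valueSet {j : Fin k → Fin D} {m : Fin D} :
    (m : ℕ) ∈ valueSet j ↔ ∃ t, j t = m := by
  simp [valueSet, Fin.ext_iff]

theorem rankBelow_valueSet {j : Fin k → Fin D} (hj : StrictMono j) (m : ℕ) :
    rankBelow (valueSet j) m = (Finset.univ.filter fun t => (j t : ℕ) < m).card := by
  rw [rankBelow, valueSet, Finset.filter_image,
    Finset.card_image_of_injective _ (val_comp_injective hj)]

theorem rankBelow_valueSet_eq_iff {j : Fin k → Fin D} (hj : StrictMono j) (m t : ℕ)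
    (ht : t ≤ k) :
    rankBelow (valueSet j) m = t ↔ ∀ a : Fin k, (j a : ℕ) < m ↔ (a : ℕ) < t := by
  rw [rankBelow_valueSet hj]
  constructor
  · rintro rfl a
    constructor
    · intro ha
      rw [Nat.lt_iff_add_one_le, ← Fin.card_Iic]
      refine Finset.card_le_card fun b hb => ?_
      have : (j b : ℕ) ≤ j a := hj.monotone (Finset.mem_Iic.1 hb)
      simpa using this.trans_lt ha
    · contrapose!
      intro ha
      rw [← Fin.card_Iio]
      refine Finset.card_le_card fun b hb => Finset.mem_Iio.2 ?_
      have hb : (j b : ℕ) < m := by simpa using hb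
      exact hj.lt_iff_lt.1 (hb.trans_le ha)
  · intro h
    simp only [h, Fin.card_filter_val_lt, min_eq_right ht]

theorem rankBelow_valueSet_apply {j : Fin k → Fin D} (hj : StrictMono j) (t : Fin k) :
    rankBelow (valueSet j) (j t) = t :=
  (rankBelow_valueSet_eq_iff hj _ _ t.isLt.le).2 fun _ => hj.lt_iff_lt

theorem rankBelow_valueSet_le {j : Fin k → Fin D} (hj : StrictMono j) (m : ℕ) :
    rankBelow (valueSet j) m ≤ k := by
  rw [rankBelow_valueSet hj]
  exact (Finset.card_le_univ _).trans_eq (Fintype.card_fin k)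

theorem card_filter_rankBelow_eq_gapExp {j : Fin k → Fin D} (hj : StrictMono j)
    (t : Fin (k + 1)) :
    (Finset.univ.filter fun m : Fin D =>
      (∀ s, j s ≠ m) ∧ rankBelow (valueSet j) m = t).card = gapExp j t := by
  have htk := t.isLt
  simp only [rankBelow_valueSet_eq_iff hj _ _ (Nat.lt_succ_iff.1 htk)]
  unfold gapExp
  split_ifs with h0 hk0 htk'
  · subst hk0
    simp [Finset.filter_true_of_mem]
  · rw [← Fin.card_Iio (j _)]
    refine congrArg Finset.card ?_
    ext m
    simp only [Finset.mem_filter_univ, Finset.mem_Iio, h0, not_lt_zero, iff_false, not_lt,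
      ne_eq, Fin.ext_iff, Fin.lt_def]
    constructor
    · rintro ⟨hne, hle⟩
      exact lt_of_le_of_ne (hle _) (Ne.symm (hne _))
    · intro hm
      have (a : Fin k) : (m : ℕ) < j a :=
        hm.trans_le (hj.monotone (Fin.mk_le_of_le_val (Nat.zero_le a)))
      exact ⟨fun a => (this a).ne', fun a => (this a).le⟩
  · rw [Nat.sub_right_comm, ← Fin.card_Ioi]
    refine congrArg Finset.card ?_
    ext m
    simp only [Finset.mem_filter_univ, Finset.mem_Ioi, htk', Fin.is_lt, iff_true,
      ne_eq, Fin.ext_iff, Fin.lt_def]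
    constructor
    · rintro ⟨-, hlt⟩
      exact hlt _
    · intro hm
      have (a : Fin k) : (j a : ℕ) < m :=
        lt_of_le_of_lt (hj.monotone (Fin.le_def.2 (Nat.le_sub_one_of_lt a.isLt))) hm
      exact ⟨fun a => (this a).ne, this⟩
  · rw [← Fin.card_Ioo]
    refine congrArg Finset.card ?_
    ext m
    simp only [Finset.mem_filter_univ, Finset.mem_Ioo, ne_eq, Fin.ext_iff, Fin.lt_def]
    constructor
    · rintro ⟨hne, h⟩
      refine ⟨(h _).2 (Nat.sub_one_lt h0), lt_of_le_of_ne ?_ (Ne.symm (hne _))⟩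
      exact not_lt.1 fun hlt => lt_irrefl _ ((h _).1 hlt)
    · rintro ⟨hm, hm'⟩
      have hlow (a : Fin k) (ha : (a : ℕ) < t) : (j a : ℕ) < m :=
        lt_of_le_of_lt (hj.monotone (Fin.le_def.2 (Nat.le_sub_one_of_lt ha))) hm
      have hhigh (a : Fin k) (ha : (t : ℕ) ≤ a) : (m : ℕ) < j a :=
        hm'.trans_le (hj.monotone (Fin.mk_le_of_le_val ha))
      refine ⟨fun a => ?_, fun a => ⟨fun h => ?_, hlow a⟩⟩
      · rcases lt_or_ge (a : ℕ) t with ha | ha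
        exacts [(hlow a ha).ne, (hhigh a ha).ne']
      · exact not_le.1 fun ha => lt_asymm h (hhigh a ha)

theorem pathWeight_valueSet {A : Type*} [CommRing A] (ξ y : ℕ → A) (x : ℕ → ℕ → A)
    {j : Fin k → Fin D} (hj : StrictMono j) :
    pathWeight ξ y x D (valueSet j) =
      (∏ t : Fin (k + 1), ξ t ^ gapExp j t) *
        ((∏ t : Fin k, x (j t) t) *
          ∏ m ∈ Finset.univ.filter (fun m : Fin D => ∀ t, j t ≠ m), y m) := by
  have hrange : (Finset.univ.filter fun m : Fin D => ∃ t, j t = m) = Finset.univ.image j := by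
    ext m
    simp
  have hξ : ∏ m ∈ Finset.univ.filter (fun m : Fin D => ∀ t, j t ≠ m),
      ξ (rankBelow (valueSet j) m) = ∏ t : Fin (k + 1), ξ t ^ gapExp j t := by
    let r (m : Fin D) : Fin (k + 1) :=
      ⟨rankBelow (valueSet j) m, Nat.lt_succ_of_le (rankBelow_valueSet_le hj m)⟩
    rw [← Finset.prod_fiberwise_of_maps_to (g := r) (t := Finset.univ)
      (fun _ _ => Finset.mem_univ _)]
    refine Finset.prod_congr rfl fun t _ => ?_
    rw [Finset.prod_eq_pow_card (b := ξ t), Finset.filter_filter,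
      ← card_filter_rankBelow_eq_gapExp hj t]
    · simp only [r, Fin.ext_iff]
    · intro m hm
      rw [← (Finset.mem_filter.1 hm).2]
  rw [pathWeight, Finset.prod_range]
  simp only [coe_mem_valueSet]
  rw [Finset.prod_ite, hrange, Finset.prod_image hj.injective.injOn]
  simp only [rankBelow_valueSet_apply hj, not_exists, Finset.prod_mul_distrib]
  rw [← hξ]
  simp only [ne_eq]
  ring

theorem sum_strictMono_valueSet {B : Type*} [AddCommMonoid B] (f : Finset ℕ → B) :
    ∑ j ∈ Finset.univ.filter (fun j : Fin k → Fin D => ∀ a b : Fin k, a < b → j a < j b),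
        f (valueSet j) =
      ∑ S ∈ (Finset.range D).powersetCard k, f S := by
  refine Finset.sum_bij (fun j _ => valueSet j) ?_ ?_ ?_ fun _ _ => rfl
  · intro j hj
    have hj : StrictMono j := fun a b => (Finset.mem_filter_univ j).1 hj a b
    rw [Finset.mem_powersetCard, valueSet,
      Finset.card_image_of_injective _ (val_comp_injective hj), Finset.card_fin]
    refine ⟨fun m hm => ?_, rfl⟩
    obtain ⟨t, -, rfl⟩ := Finset.mem_image.1 hm
    exact Finset.mem_range.2 (j t).isLt
  · intro j hj j' hj' h
    have hj : StrictMono j := fun a b => (Finset.mem_filter_univ j).1 hj a b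
    have hj' : StrictMono j' := fun a b => (Finset.mem_filter_univ j').1 hj' a b
    refine (hj.range_inj hj').1 (Set.ext fun m => ?_)
    rw [Set.mem_range, Set.mem_range, ← coe_mem_valueSet, ← coe_mem_valueSet, h]
  · intro S hS
    obtain ⟨hS, hc⟩ := Finset.mem_powersetCard.1 hS
    refine ⟨fun t => ⟨S.orderEmbOfFin hc t,
      Finset.mem_range.1 (hS (Finset.orderEmbOfFin_mem S hc t))⟩, ?_, ?_⟩
    · simp
    · simp [valueSet]

theorem stmt11 {F : Type*} [Field F] {n k D : ℕ} (hk : 1 ≤ k) (hD : k ≤ D)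
    (c : Fin D → Fin n → F) :
    ((List.ofFn fun m => matM n k (c m)).prod) 0 (Fin.last k) =
      ∑ j ∈ Finset.univ.filter (fun j : Fin k → Fin D => ∀ a b : Fin k, a < b → j a < j b),
        (∏ t : Fin (k + 1), xiVar n k t ^ gapExp j t) *
          ((∏ t : Fin k, Lx n k (c (j t)) t) *
            ∏ m ∈ Finset.univ.filter (fun m : Fin D => ∀ t, j t ≠ m), Lz n k (c m)) := by
  let ξ (l : ℕ) : MvPolynomial (RVar n k) F := if h : l < k + 1 then xiVar n k ⟨l, h⟩ else 0
  let y (m : ℕ) : MvPolynomial (RVar n k) F := if h : m < D then Lz n k (c ⟨m, h⟩) else 0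
  let x (m l : ℕ) : MvPolynomial (RVar n k) F :=
    if h : m < D ∧ l < k then Lx n k (c ⟨m, h.1⟩) ⟨l, h.2⟩ else 0
  have hlist : (List.ofFn fun m => matM n k (c m)) =
      (List.range D).map (stepMatrix ξ y x k) := by
    refine List.ext_getElem (by simp) fun m hm _ => ?_
    have hmD : m < D := by simpa using hm
    ext1 p q
    simp only [List.getElem_ofFn, List.getElem_map, List.getElem_range, matM, stepMatrix]
    split_ifs with hpq h
    · simp [ξ, y, hmD, -Order.lt_add_one_iff]
    · have hp : (p : ℕ) < k := by have := q.isLt; omega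
      simp [x, hmD, hp]
    · rfl
  rw [hlist, prod_stepMatrix_apply, Fin.val_last, ← sum_strictMono_valueSet]
  refine Finset.sum_congr rfl fun j hj => ?_
  rw [pathWeight_valueSet ξ y x fun a b => (Finset.mem_filter_univ j).1 hj a b]
  congr 1
  · exact Finset.prod_congr rfl fun t _ => by rw [show ξ t = xiVar n k t from dif_pos t.isLt]
  · simp [y, x]

end
end
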